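/- arXiv:2111.00969 — 2 statements merged into one kernel-verified Lean document; each statement's English description precedes it below -/
import Mathlib

section
/- Let N ≥ 1, let α : ℝ³ → ℝ satisfy 0 ≤ α(x) ≤ 1 for all x, let c : ℝ³ → ℝ be Lipschitz continuous with Lipschitz constant k ≥ 0, let x_s ∈ ℝ³, let Δ > 0, and let x₁, …, x_N ∈ ℝ³ satisfy ‖x_i − x_s‖ ≤ Δ for all i. Define the cumulatively rendered color Ĉ_c = ∑_{i=1}^{N-1} α(x_i) · ∏_{j<i} (1 − α(x_j)) · (c(x_i) − c(x_N)) + c(x_N), and the surface-rendered color Ĉ_s = c(x_s). Then |Ĉ_c − Ĉ_s| ≤ 2·k·N·Δ. -/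
/-- The cumulatively rendered color differs from the surface-rendered color by
at most `2 * k * N * Δ`. -/
theorem cumulative_minus_surface_le
    (N : ℕ) (hN : 1 ≤ N)
    (α : EuclideanSpace ℝ (Fin 3) → ℝ) (hα : ∀ x, 0 ≤ α x ∧ α x ≤ 1)
    (c : EuclideanSpace ℝ (Fin 3) → ℝ) (k : NNReal) (hc : LipschitzWith k c)
    (xs : EuclideanSpace ℝ (Fin 3)) (Δ : ℝ) (hΔ : 0 < Δ)
    (x : ℕ → EuclideanSpace ℝ (Fin 3)) (hx : ∀ i < N, ‖x i - xs‖ ≤ Δ) :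
    |((∑ i ∈ Finset.range (N - 1),
        (α (x i) * ∏ j ∈ Finset.range i, (1 - α (x j))) * (c (x i) - c (x (N - 1))))
      + c (x (N - 1))) - c xs| ≤ 2 * (k : ℝ) * N * Δ := by
  obtain ⟨M, rfl⟩ : ∃ M, N = M + 1 := ⟨N - 1, by omega⟩
  simp only [Nat.add_sub_cancel]
  have hcs : ∀ i ≤ M, |c (x i) - c xs| ≤ k * Δ := fun i hi => by
    have h := hc.dist_le_mul (x i) xs
    rw [Real.dist_eq, dist_eq_norm] at h
    exact h.trans (mul_le_mul_of_nonneg_left (hx i (by omega)) k.2)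
  have hweight : ∀ i, |α (x i) * ∏ j ∈ Finset.range i, (1 - α (x j))| ≤ 1 := fun i => by
    have h0 : 0 ≤ ∏ j ∈ Finset.range i, (1 - α (x j)) :=
      Finset.prod_nonneg fun j _ => sub_nonneg.2 (hα (x j)).2
    have h1 : ∏ j ∈ Finset.range i, (1 - α (x j)) ≤ 1 :=
      Finset.prod_le_one (fun j _ => sub_nonneg.2 (hα (x j)).2)
        fun j _ => sub_le_self 1 (hα (x j)).1
    rw [abs_of_nonneg (mul_nonneg (hα (x i)).1 h0)]
    exact mul_le_one₀ (hα (x i)).2 h0 h1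
  have hterm : ∀ i ∈ Finset.range M,
      |(α (x i) * ∏ j ∈ Finset.range i, (1 - α (x j))) * (c (x i) - c (x M))|
        ≤ 2 * (k * Δ) := fun i hi => by
    rw [abs_mul]
    refine (mul_le_of_le_one_left (abs_nonneg _) (hweight i)).trans ?_
    have hi' := hcs i (Finset.mem_range.1 hi).le
    have hM := hcs M le_rfl
    have htri := abs_sub_le (c (x i)) (c xs) (c (x M))
    rw [abs_sub_comm (c xs)] at htri
    linarith
  have hsum := (Finset.abs_sum_le_sum_abs _ _).trans (Finset.sum_le_card_nsmul _ _ _ hterm)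
  rw [Finset.card_range, nsmul_eq_mul] at hsum
  have hnonneg : 0 ≤ (k : ℝ) * Δ := mul_nonneg k.2 hΔ.le
  rw [add_sub_assoc]
  refine (abs_add_le _ _).trans ((add_le_add hsum (hcs M le_rfl)).trans ?_)
  push_cast
  linarith
end

section
/- Let N ≥ 1, let α : ℝ³ → ℝ satisfy 0 ≤ α(x) ≤ 1 for all x, let c : ℝ³ → ℝ be Lipschitz continuous, and let x_s ∈ ℝ³. For each Δ > 0, let x₁(Δ), …, x_N(Δ) ∈ ℝ³ be points satisfying ‖x_i(Δ) − x_s‖ ≤ Δ for all i, and define Ĉ_c(Δ) = ∑_{i=1}^{N-1} α(x_i(Δ)) · ∏_{j<i} (1 − α(x_j(Δ))) · (c(x_i(Δ)) − c(x_N(Δ))) + c(x_N(Δ)). Then Ĉ_c(Δ) tends to c(x_s) as Δ tends to 0 from the right; i.e., for every ε > 0 there exists Δ₀ > 0 such that for all 0 < Δ ≤ Δ₀, |Ĉ_c(Δ) − c(x_s)| < ε. -/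
/-- Front-to-back compositing weights, together with the remaining transmittance, sum to one. -/
theorem sum_mul_prod_one_sub_add_prod (a : ℕ → ℝ) (n : ℕ) :
    ∑ i ∈ Finset.range n, a i * ∏ j ∈ Finset.range i, (1 - a j)
      + ∏ j ∈ Finset.range n, (1 - a j) = 1 := by
  induction n with
  | zero => simp
  | succ n ih =>
    rw [Finset.sum_range_succ, Finset.prod_range_succ]
    linear_combination ih

/-- If all composited values lie within `B` of `s`, then so does the composited color. -/
theorem abs_sum_mul_prod_one_sub_sub_le (a y : ℕ → ℝ) (n : ℕ) (z s B : ℝ)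
    (ha : ∀ i, 0 ≤ a i ∧ a i ≤ 1) (hy : ∀ i < n, |y i - s| ≤ B) (hz : |z - s| ≤ B) :
    |((∑ i ∈ Finset.range n, (a i * ∏ j ∈ Finset.range i, (1 - a j)) * (y i - z)) + z) - s|
      ≤ B := by
  have hP : ∀ m, 0 ≤ ∏ j ∈ Finset.range m, (1 - a j) := fun m =>
    Finset.prod_nonneg fun j _ => sub_nonneg.2 (ha j).2
  have hw : ∀ i, 0 ≤ a i * ∏ j ∈ Finset.range i, (1 - a j) := fun i =>
    mul_nonneg (ha i).1 (hP i)
  have hsum := sum_mul_prod_one_sub_add_prod a n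
  have hsplit : ((∑ i ∈ Finset.range n,
        (a i * ∏ j ∈ Finset.range i, (1 - a j)) * (y i - z)) + z) - s
      = ∑ i ∈ Finset.range n, (a i * ∏ j ∈ Finset.range i, (1 - a j)) * (y i - s)
        + (∏ j ∈ Finset.range n, (1 - a j)) * (z - s) := by
    simp only [mul_sub, Finset.sum_sub_distrib, ← Finset.sum_mul]
    linear_combination (s - z) * hsum
  rw [hsplit]
  calc
    _ ≤ ∑ i ∈ Finset.range n, (a i * ∏ j ∈ Finset.range i, (1 - a j)) * B
        + (∏ j ∈ Finset.range n, (1 - a j)) * B := by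
      refine (abs_add_le _ _).trans (add_le_add ?_ ?_)
      · refine (Finset.abs_sum_le_sum_abs _ _).trans (Finset.sum_le_sum fun i hi => ?_)
        rw [abs_mul, abs_of_nonneg (hw i)]
        exact mul_le_mul_of_nonneg_left (hy i (Finset.mem_range.1 hi)) (hw i)
      · rw [abs_mul, abs_of_nonneg (hP n)]
        exact mul_le_mul_of_nonneg_left hz (hP n)
    _ = B := by rw [← Finset.sum_mul, ← add_mul, hsum, one_mul]


/-- Theorem 1: the cumulatively rendered color converges to the
surface-rendered color as `Δ → 0⁺`. -/
theorem cumulative_tendsto_surface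
    (N : ℕ) (hN : 1 ≤ N)
    (α : EuclideanSpace ℝ (Fin 3) → ℝ) (hα : ∀ x, 0 ≤ α x ∧ α x ≤ 1)
    (c : EuclideanSpace ℝ (Fin 3) → ℝ) (k : NNReal) (hc : LipschitzWith k c)
    (xs : EuclideanSpace ℝ (Fin 3))
    (x : ℝ → ℕ → EuclideanSpace ℝ (Fin 3))
    (hx : ∀ Δ > (0 : ℝ), ∀ i < N, ‖x Δ i - xs‖ ≤ Δ) :
    ∀ ε > (0 : ℝ), ∃ Δ₀ > (0 : ℝ), ∀ Δ : ℝ, 0 < Δ → Δ ≤ Δ₀ →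
      |((∑ i ∈ Finset.range (N - 1),
          (α (x Δ i) * ∏ j ∈ Finset.range i, (1 - α (x Δ j)))
            * (c (x Δ i) - c (x Δ (N - 1))))
        + c (x Δ (N - 1))) - c xs| < ε := by
  intro ε hε
  have hk : (0 : ℝ) < k + 1 := by positivity
  refine ⟨ε / (k + 1), div_pos hε hk, fun Δ hΔ hle => ?_⟩
  have hcolor : ∀ i < N, |c (x Δ i) - c xs| ≤ k * Δ := fun i hi => by
    rw [← Real.dist_eq]
    refine (hc.dist_le_mul _ _).trans (mul_le_mul_of_nonneg_left ?_ k.2)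
    rw [dist_eq_norm]
    exact hx Δ hΔ i hi
  refine (abs_sum_mul_prod_one_sub_sub_le (fun i => α (x Δ i)) (fun i => c (x Δ i)) (N - 1)
    (c (x Δ (N - 1))) (c xs) (k * Δ) (fun i => hα _) (fun i hi => hcolor i (by omega))
    (hcolor _ (by omega))).trans_lt ?_
  rw [le_div_iff₀ hk] at hle
  linarith
end
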